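/- arXiv:2506.13645 — 2 statements merged into one kernel-verified Lean document; each statement's English description precedes it below -/
import Mathlib

section
/- Let ν > 0 and let k₁, k₂, b₁, b₂ ∈ ℝ with |k₁| + |k₂| ≠ 0. Let I ⊆ ℝ be an open interval and let γ(t) = (k₁t + b₁, k₂t + b₂). Let U ⊆ ℝ×ℝ be an open set containing γ(I), and let u₁, u₂, f₁, f₂, g₁, g₂, p, φ : ℝ×ℝ → ℝ be smooth. Suppose that at every point of U: −ν·Δu₁ + p_x = f₁, −ν·Δu₂ + p_y = f₂, and −(u₁)_x − (u₂)_y = φ; and suppose u₁(γ(t)) = g₁(γ(t)) and u₂(γ(t)) = g₂(γ(t)) for all t ∈ I. Then at every point γ(t) with t ∈ I: k₁²(k₁ − 3k₂)·(u₁)_xxx + k₁(2k₁² + 3k₁k₂ − 3k₂²)·(u₁)_xxy + k₂²(3k₁ − k₂)·(u₁)_xyy + (k₁³ + k₂³)·(u₁)_yyy = 3k₁²k₂·φ_xx + k₁(3k₂² − k₁²)·φ_xy + k₂³·φ_yy + ν⁻¹·k₁³·((f₂)_x − (f₁)_y) + ρ₁ + ρ₂, where ρ_r = k₁³·(g_r)_xxx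 + 3k₁²k₂·(g_r)_xxy + 3k₁k₂²·(g_r)_xyy + k₂³·(g_r)_yyy for r = 1, 2. -/
/-- Partial derivative in the `x`-direction. -/
noncomputable def px (v : ℝ × ℝ → ℝ) : ℝ × ℝ → ℝ := fun z => fderiv ℝ v z (1, 0)

/-- Partial derivative in the `y`-direction. -/
noncomputable def py (v : ℝ × ℝ → ℝ) : ℝ × ℝ → ℝ := fun z => fderiv ℝ v z (0, 1)

/-- Laplacian `Δv = v_xx + v_yy`. -/
noncomputable def lap (v : ℝ × ℝ → ℝ) : ℝ × ℝ → ℝ := fun z => px (px v) z + py (py v) z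

theorem aux_smooth (v : ℝ × ℝ → ℝ) (h : ContDiff ℝ (⊤ : ℕ∞) v) (e : ℝ × ℝ) :
    ContDiff ℝ (⊤ : ℕ∞) (fun z => fderiv ℝ v z e) :=
  (h.fderiv_right (m := (⊤ : ℕ∞)) (by simp)).clm_apply contDiff_const

theorem px_smooth {v : ℝ × ℝ → ℝ} (h : ContDiff ℝ (⊤ : ℕ∞) v) :
    ContDiff ℝ (⊤ : ℕ∞) (px v) := aux_smooth v h _

theorem py_smooth {v : ℝ × ℝ → ℝ} (h : ContDiff ℝ (⊤ : ℕ∞) v) :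
    ContDiff ℝ (⊤ : ℕ∞) (py v) := aux_smooth v h _

theorem smooth_diff {v : ℝ × ℝ → ℝ} (h : ContDiff ℝ (⊤ : ℕ∞) v) : Differentiable ℝ v :=
  h.differentiable (by simp)

theorem px_py_comm {v : ℝ × ℝ → ℝ} (h : ContDiff ℝ (⊤ : ℕ∞) v) : py (px v) = px (py v) := by
  funext z
  have hd : DifferentiableAt ℝ (fderiv ℝ v) z :=
    ((h.fderiv_right (m := (⊤ : ℕ∞)) (by simp)).differentiable (by simp)) z
  have hs : IsSymmSndFDerivAt ℝ v z :=
    h.contDiffAt.isSymmSndFDerivAt (by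
      rw [minSmoothness_of_isRCLikeNormedField]
      exact WithTop.coe_le_coe.2 (le_top : (2 : ℕ∞) ≤ ⊤))
  have key : ∀ e e' : ℝ × ℝ, fderiv ℝ (fun w => fderiv ℝ v w e) z e'
      = fderiv ℝ (fderiv ℝ v) z e' e := by
    intro e e'
    rw [fderiv_clm_apply hd (differentiableAt_const e)]
    simp
  unfold px py
  rw [key, key]
  exact hs _ _

theorem px_lin {v w : ℝ × ℝ → ℝ} (hv : ContDiff ℝ (⊤ : ℕ∞) v) (hw : ContDiff ℝ (⊤ : ℕ∞) w)
    (c d : ℝ) (z : ℝ × ℝ) :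
    px (fun z => c * v z + d * w z) z = c * px v z + d * px w z := by
  have h := (((smooth_diff hv z).hasFDerivAt.const_mul c).add
    ((smooth_diff hw z).hasFDerivAt.const_mul d)).fderiv
  have h2 := congrArg (fun L : ℝ × ℝ →L[ℝ] ℝ => L (1, 0)) h
  simp only [ContinuousLinearMap.add_apply, ContinuousLinearMap.smul_apply, smul_eq_mul] at h2
  exact h2

theorem py_lin {v w : ℝ × ℝ → ℝ} (hv : ContDiff ℝ (⊤ : ℕ∞) v) (hw : ContDiff ℝ (⊤ : ℕ∞) w)
    (c d : ℝ) (z : ℝ × ℝ) :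
    py (fun z => c * v z + d * w z) z = c * py v z + d * py w z := by
  have h := (((smooth_diff hv z).hasFDerivAt.const_mul c).add
    ((smooth_diff hw z).hasFDerivAt.const_mul d)).fderiv
  have h2 := congrArg (fun L : ℝ × ℝ →L[ℝ] ℝ => L (0, 1)) h
  simp only [ContinuousLinearMap.add_apply, ContinuousLinearMap.smul_apply, smul_eq_mul] at h2
  exact h2

theorem px_congr {U : Set (ℝ × ℝ)} (hU : IsOpen U) {v w : ℝ × ℝ → ℝ}
    (h : ∀ z ∈ U, v z = w z) : ∀ z ∈ U, px v z = px w z := by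
  intro z hz
  have : v =ᶠ[nhds z] w := Filter.eventually_of_mem (hU.mem_nhds hz) h
  unfold px
  rw [this.fderiv_eq]

theorem py_congr {U : Set (ℝ × ℝ)} (hU : IsOpen U) {v w : ℝ × ℝ → ℝ}
    (h : ∀ z ∈ U, v z = w z) : ∀ z ∈ U, py v z = py w z := by
  intro z hz
  have : v =ᶠ[nhds z] w := Filter.eventually_of_mem (hU.mem_nhds hz) h
  unfold py
  rw [this.fderiv_eq]

/-- Derivative in the direction `(k, l)`. -/
noncomputable def dirD (k l : ℝ) (v : ℝ × ℝ → ℝ) : ℝ × ℝ → ℝ := fun z => k * px v z + l * py v z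

theorem dirD_smooth (k l : ℝ) {v : ℝ × ℝ → ℝ} (h : ContDiff ℝ (⊤ : ℕ∞) v) :
    ContDiff ℝ (⊤ : ℕ∞) (dirD k l v) :=
  (contDiff_const.mul (px_smooth h)).add (contDiff_const.mul (py_smooth h))

theorem line_deriv (k l c d : ℝ) {v : ℝ × ℝ → ℝ} (h : ContDiff ℝ (⊤ : ℕ∞) v) (t : ℝ) :
    HasDerivAt (fun t : ℝ => v (k * t + c, l * t + d)) (dirD k l v (k * t + c, l * t + d)) t := by
  have h1 : HasDerivAt (fun t : ℝ => k * t + c) k t := by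
    simpa using ((hasDerivAt_id t).const_mul k).add_const c
  have h2 : HasDerivAt (fun t : ℝ => l * t + d) l t := by
    simpa using ((hasDerivAt_id t).const_mul l).add_const d
  have h3 := (smooth_diff h (k * t + c, l * t + d)).hasFDerivAt.comp_hasDerivAt t (h1.prodMk h2)
  have e : ((k, l) : ℝ × ℝ) = k • ((1, 0) : ℝ × ℝ) + l • ((0, 1) : ℝ × ℝ) := by simp
  rw [e, map_add, map_smul, map_smul] at h3
  exact h3

theorem dirD_congr (k l c d a b : ℝ) {v w : ℝ × ℝ → ℝ} (hv : ContDiff ℝ (⊤ : ℕ∞) v)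
    (hw : ContDiff ℝ (⊤ : ℕ∞) w)
    (h : ∀ t ∈ Set.Ioo a b, v (k * t + c, l * t + d) = w (k * t + c, l * t + d)) :
    ∀ t ∈ Set.Ioo a b,
      dirD k l v (k * t + c, l * t + d) = dirD k l w (k * t + c, l * t + d) := by
  intro t ht
  have : (fun t : ℝ => w (k * t + c, l * t + d)) =ᶠ[nhds t]
      (fun t : ℝ => v (k * t + c, l * t + d)) :=
    Filter.eventually_of_mem (isOpen_Ioo.mem_nhds ht) (fun s hs => (h s hs).symm)
  exact ((line_deriv k l c d hv t).congr_of_eventuallyEq this).unique (line_deriv k l c d hw t)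

theorem dirD_two (k l : ℝ) {v : ℝ × ℝ → ℝ} (h : ContDiff ℝ (⊤ : ℕ∞) v) (z : ℝ × ℝ) :
    dirD k l (dirD k l v) z
      = k ^ 2 * px (px v) z + 2 * k * l * px (py v) z + l ^ 2 * py (py v) z := by
  have e1 : px (dirD k l v) z = _ := px_lin (px_smooth h) (py_smooth h) k l z
  have e2 : py (dirD k l v) z = _ := py_lin (px_smooth h) (py_smooth h) k l z
  rw [px_py_comm h] at e2
  rw [dirD, e1, e2]
  ring

theorem dirD_three (k l : ℝ) {v : ℝ × ℝ → ℝ} (h : ContDiff ℝ (⊤ : ℕ∞) v) (z : ℝ × ℝ) :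
    dirD k l (dirD k l (dirD k l v)) z
      = k ^ 3 * px (px (px v)) z + 3 * k ^ 2 * l * px (px (py v)) z
        + 3 * k * l ^ 2 * px (py (py v)) z + l ^ 3 * py (py (py v)) z := by
  have hx := px_smooth h
  have hy := py_smooth h
  have e1 : ∀ z, px (dirD k l v) z = dirD k l (px v) z := by
    intro z
    have : px (dirD k l v) z = _ := px_lin hx hy k l z
    rw [this, dirD, px_py_comm h]
  have e2 : ∀ z, py (dirD k l v) z = dirD k l (py v) z := by
    intro z
    have : py (dirD k l v) z = _ := py_lin hx hy k l z
    rw [this, dirD, px_py_comm h]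
  have e1' : px (dirD k l v) = dirD k l (px v) := funext e1
  have e2' : py (dirD k l v) = dirD k l (py v) := funext e2
  rw [dirD_two k l (dirD_smooth k l h), e1', e2']
  have a1 : px (px (dirD k l v)) z = k * px (px (px v)) z + l * px (px (py v)) z := by
    rw [e1']
    have : px (dirD k l (px v)) z = _ := px_lin (px_smooth hx) (py_smooth hx) k l z
    rw [this, px_py_comm h]
  have a2 : px (py (dirD k l v)) z = k * px (px (py v)) z + l * px (py (py v)) z := by
    rw [e2']
    exact px_lin (px_smooth hy) (py_smooth hy) k l z
  have a3 : py (py (dirD k l v)) z = k * px (py (py v)) z + l * py (py (py v)) z := by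
    rw [e2']
    have : py (dirD k l (py v)) z = _ := py_lin (px_smooth hy) (py_smooth hy) k l z
    rw [this, px_py_comm hy]
  rw [← e1', ← e2', a1, a2, a3]
  ring

theorem third_order_boundary_pde_u1
    (ν k₁ k₂ b₁ b₂ : ℝ) (hν : 0 < ν) (hk : |k₁| + |k₂| ≠ 0)
    (a b : ℝ) (U : Set (ℝ × ℝ)) (hU : IsOpen U)
    (hγU : ∀ t ∈ Set.Ioo a b, (k₁ * t + b₁, k₂ * t + b₂) ∈ U)
    (u₁ u₂ f₁ f₂ g₁ g₂ p φ : ℝ × ℝ → ℝ)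
    (hu₁ : ContDiff ℝ (⊤ : ℕ∞) u₁) (hu₂ : ContDiff ℝ (⊤ : ℕ∞) u₂)
    (hf₁ : ContDiff ℝ (⊤ : ℕ∞) f₁) (hf₂ : ContDiff ℝ (⊤ : ℕ∞) f₂)
    (hg₁ : ContDiff ℝ (⊤ : ℕ∞) g₁) (hg₂ : ContDiff ℝ (⊤ : ℕ∞) g₂)
    (hp : ContDiff ℝ (⊤ : ℕ∞) p) (hφ : ContDiff ℝ (⊤ : ℕ∞) φ)
    (hm1 : ∀ z ∈ U, -ν * lap u₁ z + px p z = f₁ z)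
    (hm2 : ∀ z ∈ U, -ν * lap u₂ z + py p z = f₂ z)
    (hdiv : ∀ z ∈ U, -(px u₁ z) - py u₂ z = φ z)
    (hb1 : ∀ t ∈ Set.Ioo a b, u₁ (k₁ * t + b₁, k₂ * t + b₂) = g₁ (k₁ * t + b₁, k₂ * t + b₂))
    (hb2 : ∀ t ∈ Set.Ioo a b, u₂ (k₁ * t + b₁, k₂ * t + b₂) = g₂ (k₁ * t + b₁, k₂ * t + b₂)) :
    ∀ t ∈ Set.Ioo a b, ∀ z : ℝ × ℝ, z = (k₁ * t + b₁, k₂ * t + b₂) →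
      k₁ ^ 2 * (k₁ - 3 * k₂) * px (px (px u₁)) z
        + k₁ * (2 * k₁ ^ 2 + 3 * k₁ * k₂ - 3 * k₂ ^ 2) * px (px (py u₁)) z
        + k₂ ^ 2 * (3 * k₁ - k₂) * px (py (py u₁)) z
        + (k₁ ^ 3 + k₂ ^ 3) * py (py (py u₁)) z
      = 3 * k₁ ^ 2 * k₂ * px (px φ) z
        + k₁ * (3 * k₂ ^ 2 - k₁ ^ 2) * px (py φ) z
        + k₂ ^ 3 * py (py φ) z
        + ν⁻¹ * k₁ ^ 3 * (px f₂ z - py f₁ z)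
        + (k₁ ^ 3 * px (px (px g₁)) z + 3 * k₁ ^ 2 * k₂ * px (px (py g₁)) z
            + 3 * k₁ * k₂ ^ 2 * px (py (py g₁)) z + k₂ ^ 3 * py (py (py g₁)) z)
        + (k₁ ^ 3 * px (px (px g₂)) z + 3 * k₁ ^ 2 * k₂ * px (px (py g₂)) z
            + 3 * k₁ * k₂ ^ 2 * px (py (py g₂)) z + k₂ ^ 3 * py (py (py g₂)) z) := by
  intro t ht z hz
  have hzU : z ∈ U := hz ▸ hγU t ht
  have B1 := dirD_congr k₁ k₂ b₁ b₂ a b (dirD_smooth k₁ k₂ (dirD_smooth k₁ k₂ hu₁))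
    (dirD_smooth k₁ k₂ (dirD_smooth k₁ k₂ hg₁))
    (dirD_congr k₁ k₂ b₁ b₂ a b (dirD_smooth k₁ k₂ hu₁) (dirD_smooth k₁ k₂ hg₁)
      (dirD_congr k₁ k₂ b₁ b₂ a b hu₁ hg₁ hb1)) t ht
  have B2 := dirD_congr k₁ k₂ b₁ b₂ a b (dirD_smooth k₁ k₂ (dirD_smooth k₁ k₂ hu₂))
    (dirD_smooth k₁ k₂ (dirD_smooth k₁ k₂ hg₂))
    (dirD_congr k₁ k₂ b₁ b₂ a b (dirD_smooth k₁ k₂ hu₂) (dirD_smooth k₁ k₂ hg₂)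
      (dirD_congr k₁ k₂ b₁ b₂ a b hu₂ hg₂ hb2)) t ht
  rw [← hz, dirD_three _ _ hu₁, dirD_three _ _ hg₁] at B1
  rw [← hz, dirD_three _ _ hu₂, dirD_three _ _ hg₂] at B2
  have xu := px_smooth hu₁
  have yu := py_smooth hu₁
  have xv := px_smooth hu₂
  have yv := py_smooth hu₂
  -- divergence equation, differentiated twice
  have D0 : ∀ z ∈ U, φ z = (-1) * px u₁ z + (-1) * py u₂ z := by
    intro z hz
    rw [← hdiv z hz]; ring
  have Dx : ∀ z ∈ U, px φ z = (-1) * px (px u₁) z + (-1) * px (py u₂) z := by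
    intro z hz
    rw [px_congr hU D0 z hz, px_lin xu yv]
  have Dy : ∀ z ∈ U, py φ z = (-1) * px (py u₁) z + (-1) * py (py u₂) z := by
    intro z hz
    rw [py_congr hU D0 z hz, py_lin xu yv, px_py_comm hu₁]
  have Dxx : px (px φ) z = (-1) * px (px (px u₁)) z + (-1) * px (px (py u₂)) z := by
    rw [px_congr hU Dx z hzU, px_lin (px_smooth xu) (px_smooth yv)]
  have Dxy : px (py φ) z = (-1) * px (px (py u₁)) z + (-1) * px (py (py u₂)) z := by
    rw [px_congr hU Dy z hzU, px_lin (px_smooth yu) (py_smooth yv)]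
  have Dyy : py (py φ) z = (-1) * px (py (py u₁)) z + (-1) * py (py (py u₂)) z := by
    rw [py_congr hU Dy z hzU, py_lin (px_smooth yu) (py_smooth yv), px_py_comm yu]
  -- curl of the momentum equations
  have slap : ∀ {v : ℝ × ℝ → ℝ}, ContDiff ℝ (⊤ : ℕ∞) v → ContDiff ℝ (⊤ : ℕ∞) (lap v) :=
    fun h => (px_smooth (px_smooth h)).add (py_smooth (py_smooth h))
  have lapE : ∀ v : ℝ × ℝ → ℝ, lap v = fun z => 1 * px (px v) z + 1 * py (py v) z := by
    intro v; funext z; simp [lap]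
  have M1 : py f₁ z = -ν * (px (px (py u₁)) z + py (py (py u₁)) z) + px (py p) z := by
    have h : ∀ z ∈ U, f₁ z = -ν * lap u₁ z + 1 * px p z := by
      intro z hz
      rw [← hm1 z hz]; ring
    rw [py_congr hU h z hzU, py_lin (slap hu₁) (px_smooth hp), lapE,
      py_lin (px_smooth xu) (py_smooth yu), px_py_comm xu, px_py_comm hu₁, px_py_comm hp]
    ring
  have M2 : px f₂ z = -ν * (px (px (px u₂)) z + px (py (py u₂)) z) + px (py p) z := by
    have h : ∀ z ∈ U, f₂ z = -ν * lap u₂ z + 1 * py p z := by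
      intro z hz
      rw [← hm2 z hz]; ring
    rw [px_congr hU h z hzU, px_lin (slap hu₂) (py_smooth hp), lapE,
      px_lin (px_smooth xv) (py_smooth yv)]
    ring
  have F : ν⁻¹ * k₁ ^ 3 * (px f₂ z - py f₁ z)
      = k₁ ^ 3 * ((px (px (py u₁)) z + py (py (py u₁)) z)
        - (px (px (px u₂)) z + px (py (py u₂)) z)) := by
    rw [M1, M2]
    field_simp
    ring
  rw [F, Dxx, Dxy, Dyy]
  linear_combination B1 + B2
end

section
/- Let ν > 0, let α ∈ ℝ, let (a,b) ⊆ ℝ be an open interval, and let U ⊆ ℝ×ℝ be an open set containing the vertical segment {(α, y) : y ∈ (a,b)}. Let u₁, u₂, f₁, f₂, p, φ, g₁ : ℝ×ℝ → ℝ be smooth functions such that at every point of U: −ν·Δu₁ + p_x = f₁, −ν·Δu₂ + p_y = f₂, and −(u₁)_x − (u₂)_y = φ; and such that u₁(α, y) = g₁(α, y) for all y ∈ (a,b). Then for every y ∈ (a,b): (u₂)_xxx(α, y) + 2·(u₂)_xyy(α, y) = ν⁻¹·((f₁)_y(α, y) − (f₂)_x(α, y)) − φ_xy(α, y) + (g₁)_yyy(α,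 y). -/
lemma aux_px_smooth {v : ℝ × ℝ → ℝ} (hv : ContDiff ℝ (⊤ : ℕ∞) v) :
    ContDiff ℝ (⊤ : ℕ∞) (px v) := by
  unfold px
  exact (hv.fderiv_right (m := (⊤ : ℕ∞)) (by simp)).clm_apply contDiff_const

lemma aux_py_smooth {v : ℝ × ℝ → ℝ} (hv : ContDiff ℝ (⊤ : ℕ∞) v) :
    ContDiff ℝ (⊤ : ℕ∞) (py v) := by
  unfold py
  exact (hv.fderiv_right (m := (⊤ : ℕ∞)) (by simp)).clm_apply contDiff_const

lemma aux_diff {v : ℝ × ℝ → ℝ} (hv : ContDiff ℝ (⊤ : ℕ∞) v) (z : ℝ × ℝ) :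
    DifferentiableAt ℝ v z :=
  (hv.differentiable (by simp)) z

lemma aux_comm {v : ℝ × ℝ → ℝ} (hv : ContDiff ℝ (⊤ : ℕ∞) v) (z : ℝ × ℝ) :
    px (py v) z = py (px v) z := by
  have hd : DifferentiableAt ℝ (fderiv ℝ v) z :=
    ((hv.fderiv_right (m := (⊤ : ℕ∞)) (by simp)).differentiable (by simp)) z
  have hs : IsSymmSndFDerivAt ℝ v z := by
    apply hv.contDiffAt.isSymmSndFDerivAt
    simp only [minSmoothness_of_isRCLikeNormedField]
    exact WithTop.coe_le_coe.2 (le_top : (2 : ℕ∞) ≤ ⊤)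
  have e : ∀ c d : ℝ × ℝ, fderiv ℝ (fun w => fderiv ℝ v w c) z d
      = fderiv ℝ (fderiv ℝ v) z d c := by
    intro c d
    rw [fderiv_clm_apply hd (differentiableAt_const c)]
    simp
  unfold px py
  rw [e, e]
  exact hs _ _

/-- A linear relation on an open set may be differentiated. -/
lemma aux_lin {U : Set (ℝ × ℝ)} (hU : IsOpen U) {A B C D : ℝ × ℝ → ℝ} (c d e : ℝ)
    (hA : ContDiff ℝ (⊤ : ℕ∞) A) (hB : ContDiff ℝ (⊤ : ℕ∞) B) (hC : ContDiff ℝ (⊤ : ℕ∞) C)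
    (h : ∀ z ∈ U, c * A z + d * B z + e * C z = D z) (w : ℝ × ℝ) (z : ℝ × ℝ) (hz : z ∈ U) :
    c * fderiv ℝ A z w + d * fderiv ℝ B z w + e * fderiv ℝ C z w = fderiv ℝ D z w := by
  have he : (fun z => c * A z + d * B z + e * C z) =ᶠ[nhds z] D :=
    Filter.eventually_of_mem (hU.mem_nhds hz) h
  have h1 := (((aux_diff hA z).hasFDerivAt.const_mul c).add
    ((aux_diff hB z).hasFDerivAt.const_mul d)).add ((aux_diff hC z).hasFDerivAt.const_mul e)
  have h2 := h1.congr_of_eventuallyEq (f₁ := D) (he.symm.trans (Filter.Eventually.of_forall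
    (fun _ => rfl)))
  rw [h2.fderiv]
  simp

/-- Tangential differentiation along a vertical segment. -/
lemma aux_tan {α a b : ℝ} {v w : ℝ × ℝ → ℝ} (hv : ContDiff ℝ (⊤ : ℕ∞) v)
    (hw : ContDiff ℝ (⊤ : ℕ∞) w) (h : ∀ y ∈ Set.Ioo a b, v (α, y) = w (α, y)) :
    ∀ y ∈ Set.Ioo a b, py v (α, y) = py w (α, y) := by
  intro y hy
  have key : ∀ u : ℝ × ℝ → ℝ, ContDiff ℝ (⊤ : ℕ∞) u →
      HasDerivAt (fun t => u (α, t)) (py u (α, y)) y := by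
    intro u hu
    have hl : HasDerivAt (fun t : ℝ => (α, t)) ((0 : ℝ), (1 : ℝ)) y :=
      (hasDerivAt_const y α).prodMk (hasDerivAt_id y)
    exact (aux_diff hu (α, y)).hasFDerivAt.comp_hasDerivAt y hl
  have he : (fun t => w (α, t)) =ᶠ[nhds y] (fun t => v (α, t)) :=
    Filter.eventually_of_mem (isOpen_Ioo.mem_nhds hy) (fun t ht => (h t ht).symm)
  exact ((key v hv).congr_of_eventuallyEq he).unique (key w hw)

theorem vertical_boundary_condition_u2
    (ν : ℝ) (hν : 0 < ν) (α a b : ℝ) (U : Set (ℝ × ℝ)) (hU : IsOpen U)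
    (hseg : ∀ y ∈ Set.Ioo a b, (α, y) ∈ U)
    (u₁ u₂ f₁ f₂ p φ g₁ : ℝ × ℝ → ℝ)
    (hu₁ : ContDiff ℝ (⊤ : ℕ∞) u₁) (hu₂ : ContDiff ℝ (⊤ : ℕ∞) u₂)
    (hf₁ : ContDiff ℝ (⊤ : ℕ∞) f₁) (hf₂ : ContDiff ℝ (⊤ : ℕ∞) f₂)
    (hp : ContDiff ℝ (⊤ : ℕ∞) p) (hφ : ContDiff ℝ (⊤ : ℕ∞) φ)
    (hg₁ : ContDiff ℝ (⊤ : ℕ∞) g₁)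
    (hm1 : ∀ z ∈ U, -ν * lap u₁ z + px p z = f₁ z)
    (hm2 : ∀ z ∈ U, -ν * lap u₂ z + py p z = f₂ z)
    (hdiv : ∀ z ∈ U, -(px u₁ z) - py u₂ z = φ z)
    (hbc : ∀ y ∈ Set.Ioo a b, u₁ (α, y) = g₁ (α, y)) :
    ∀ y ∈ Set.Ioo a b,
      px (px (px u₂)) (α, y) + 2 * px (py (py u₂)) (α, y)
        = ν⁻¹ * (py f₁ (α, y) - px f₂ (α, y)) - px (py φ) (α, y)
          + py (py (py g₁)) (α, y) := by
  intro y hy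
  have hz := hseg y hy
  have x1 := aux_px_smooth hu₁
  have y1 := aux_py_smooth hu₁
  have x2 := aux_px_smooth hu₂
  have y2 := aux_py_smooth hu₂
  have E1 := aux_lin hU (-ν) (-ν) 1 (aux_px_smooth x1) (aux_py_smooth y1) (aux_px_smooth hp)
    (D := f₁) (fun z hz => by rw [← hm1 z hz]; unfold lap; ring) (0, 1) _ hz
  have E2 := aux_lin hU (-ν) (-ν) 1 (aux_px_smooth x2) (aux_py_smooth y2) (aux_py_smooth hp)
    (D := f₂) (fun z hz => by rw [← hm2 z hz]; unfold lap; ring) (1, 0) _ hz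
  have E3 := aux_lin hU (-1) (-1) 0 x1 y2 x1
    (D := φ) (fun z hz => by rw [← hdiv z hz]; ring) (0, 1)
  have E4 := aux_lin hU (-1) (-1) 0 (aux_py_smooth x1) (aux_py_smooth y2) (aux_py_smooth x1)
    (D := py φ) E3 (1, 0) _ hz
  have E5 := aux_tan (aux_py_smooth y1) (aux_py_smooth (aux_py_smooth hg₁))
    (aux_tan y1 (aux_py_smooth hg₁) (aux_tan hu₁ hg₁ hbc)) y hy
  have C1 := aux_comm x1 (α, y)
  have C2 := aux_comm hp (α, y)
  change -ν * py (px (px u₁)) (α, y) + -ν * py (py (py u₁)) (α, y) + 1 * py (px p) (α, y)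
    = py f₁ (α, y) at E1
  change -ν * px (px (px u₂)) (α, y) + -ν * px (py (py u₂)) (α, y) + 1 * px (py p) (α, y)
    = px f₂ (α, y) at E2
  change -1 * px (py (px u₁)) (α, y) + -1 * px (py (py u₂)) (α, y)
    + 0 * px (py (px u₁)) (α, y) = px (py φ) (α, y) at E4
  rw [← E1, ← E2, ← E4, ← E5, C1, C2]
  have := hν.ne'
  field_simp
  ring
end
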